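/- For every graph database x ∈ {0,1}^{V×V} and every pair of disjoint subsets S, T ⊆ V, the cut-query estimator satisfies E_{Y∼E(x)}[|q̂_{S,T}(Y) − q_{S,T}(x)|] ≤ ((1+e^{−ε})/(1−e^{−ε}))·√(|S|·|T|). -/

import Mathlib

open Finset

/-- Hamming distance between graph databases (adjacency indicators on `V × V`). -/
def hamG {V : Type*} [Fintype V] [DecidableEq V] (x y : V × V → Bool) : ℕ :=
  (Finset.univ.filter fun e => x e ≠ y e).card

/-- The pmf of the mechanism `E` on graph databases (data universe `{0,1}`, size `|V|²`). -/
noncomputable def pEG {V : Type*} [Fintype V] [DecidableEq V] (ε : ℝ) (x y : V × V → Bool) : ℝ :=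
  Real.exp (-ε * (hamG x y : ℝ)) / (1 + Real.exp (-ε)) ^ (Fintype.card V ^ 2)

/-- The cut query `q_{S,T}(x) = |{(i,j) ∈ S × T : x_{i,j} = 1}|`. -/
def cutQ {V : Type*} [Fintype V] [DecidableEq V] (S T : Finset V) (x : V × V → Bool) : ℝ :=
  ∑ e ∈ S ×ˢ T, (if x e then 1 else 0)

/-- The cut-query estimator
`q̂_{S,T}(y) = ((1+e^{-ε})/(1-e^{-ε})) q_{S,T}(y) - (e^{-ε}/(1-e^{-ε})) |S||T|`. -/
noncomputable def cutEst {V : Type*} [Fintype V] [DecidableEq V] (ε : ℝ) (S T : Finset V)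
    (y : V × V → Bool) : ℝ :=
  ((1 + Real.exp (-ε)) / (1 - Real.exp (-ε))) * cutQ S T y
    - (Real.exp (-ε) / (1 - Real.exp (-ε))) * ((S.card : ℝ) * T.card)

/-- The expectation, under a product weight on `ι → κ`, of a product of functions of the
individual coordinates. -/
theorem sum_prod_weight_mul_prod {ι κ : Type*} [Fintype ι] [DecidableEq ι] [Fintype κ]
    (w h : ι → κ → ℝ) :
    ∑ y : ι → κ, (∏ i, w i (y i)) * ∏ i, h i (y i) = ∏ i, ∑ b, w i b * h i b := by
  simp_rw [← Finset.prod_mul_distrib]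
  exact (Fintype.prod_sum fun i b => w i b * h i b).symm

theorem sum_prod_weight {ι κ : Type*} [Fintype ι] [DecidableEq ι] [Fintype κ]
    (w : ι → κ → ℝ) (hw : ∀ i, ∑ b, w i b = 1) :
    ∑ y : ι → κ, ∏ i, w i (y i) = 1 := by
  simpa [hw] using sum_prod_weight_mul_prod w fun _ _ => 1

theorem sum_prod_weight_mul_apply {ι κ : Type*} [Fintype ι] [DecidableEq ι] [Fintype κ]
    (w : ι → κ → ℝ) (hw : ∀ i, ∑ b, w i b = 1) (e : ι) (g : κ → ℝ) :
    ∑ y : ι → κ, (∏ i, w i (y i)) * g (y e) = ∑ b, w e b * g b := by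
  have key := sum_prod_weight_mul_prod w fun i b => if i = e then g b else 1
  rw [Fintype.prod_eq_single e (fun i hi => by simp [hi, hw])] at key
  simpa using key

theorem sum_prod_weight_mul_apply_mul_apply {ι κ : Type*} [Fintype ι] [DecidableEq ι] [Fintype κ]
    (w : ι → κ → ℝ) {e f : ι} (hef : e ≠ f) (g h : κ → ℝ)
    (hg : ∑ b, w e b * g b = 0) :
    ∑ y : ι → κ, (∏ i, w i (y i)) * (g (y e) * h (y f)) = 0 := by
  have key := sum_prod_weight_mul_prod w fun i b =>
    (if i = e then g b else 1) * (if i = f then h b else 1)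
  rw [Finset.prod_eq_zero (Finset.mem_univ e) (by simpa [hef] using hg)] at key
  simp_rw [Finset.prod_mul_distrib] at key
  simpa only [Finset.prod_ite_eq', Finset.mem_univ, if_true] using key

/-- The second moment of a sum of independent centred variables is the sum of the second
moments. -/
theorem sum_prod_weight_mul_sum_sq {ι κ : Type*} [Fintype ι] [DecidableEq ι] [Fintype κ]
    (w : ι → κ → ℝ) (hw : ∀ i, ∑ b, w i b = 1) (g : ι → κ → ℝ)
    (hg : ∀ i, ∑ b, w i b * g i b = 0) (s : Finset ι) :
    ∑ y : ι → κ, (∏ i, w i (y i)) * (∑ e ∈ s, g e (y e)) ^ 2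
      = ∑ e ∈ s, ∑ b, w e b * g e b ^ 2 := by
  simp_rw [sq (∑ e ∈ s, _), Finset.sum_mul_sum, Finset.mul_sum]
  rw [Finset.sum_comm]
  refine Finset.sum_congr rfl fun e he => ?_
  rw [Finset.sum_comm, Finset.sum_eq_single_of_mem e he fun f _ hf =>
    sum_prod_weight_mul_apply_mul_apply w hf.symm _ _ (hg e)]
  simp_rw [← sq]
  exact sum_prod_weight_mul_apply w hw e fun b => g e b ^ 2

theorem sum_mul_abs_le_sqrt {α : Type*} [Fintype α] (p Z : α → ℝ) (hp : ∀ a, 0 ≤ p a)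
    (hp1 : ∑ a, p a = 1) :
    ∑ a, p a * |Z a| ≤ √(∑ a, p a * Z a ^ 2) := by
  refine Real.le_sqrt_of_sq_le ?_
  have := Finset.sum_sq_le_sum_mul_sum_of_sq_le_mul Finset.univ (r := fun a => p a * |Z a|)
    (f := p) (g := fun a => p a * Z a ^ 2) (fun a _ => hp a)
    (fun a _ => mul_nonneg (hp a) (sq_nonneg _))
    (fun a _ => by rw [mul_pow, sq_abs, sq (p a), mul_assoc])
  rwa [hp1, one_mul] at this

/-- The probability that randomized response turns the bit `b` into `b'`. -/
noncomputable def bitWeight (ε : ℝ) (b b' : Bool) : ℝ :=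
  (if b ≠ b' then Real.exp (-ε) else 1) / (1 + Real.exp (-ε))

theorem bitWeight_nonneg (ε : ℝ) (b b' : Bool) : 0 ≤ bitWeight ε b b' := by
  unfold bitWeight
  split_ifs <;> positivity

theorem sum_bitWeight (ε : ℝ) (b : Bool) : ∑ b', bitWeight ε b b' = 1 := by
  have h : 1 + Real.exp (-ε) ≠ 0 := by positivity
  cases b <;> simp [bitWeight] <;> field_simp
  ring

theorem pEG_eq_prod {V : Type*} [Fintype V] [DecidableEq V] (ε : ℝ) (x y : V × V → Bool) :
    pEG ε x y = ∏ e, bitWeight ε (x e) (y e) := by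
  simp only [pEG, bitWeight, hamG, Finset.prod_div_distrib]
  rw [← Finset.prod_filter, Finset.prod_const, Finset.prod_const, Finset.card_univ,
    Fintype.card_prod, ← sq, mul_comm, Real.exp_nat_mul]

/-- The contribution of a single bit to the error of the cut-query estimator. -/
noncomputable def bitError (ε : ℝ) (b b' : Bool) : ℝ :=
  (1 + Real.exp (-ε)) / (1 - Real.exp (-ε)) * (if b' then 1 else 0)
    - Real.exp (-ε) / (1 - Real.exp (-ε)) - (if b then 1 else 0)

theorem sum_bitWeight_mul_bitError {ε : ℝ} (hε : 0 < ε) (b : Bool) :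
    ∑ b', bitWeight ε b b' * bitError ε b b' = 0 := by
  have h : 1 + Real.exp (-ε) ≠ 0 := by positivity
  have h' : 1 - Real.exp (-ε) ≠ 0 := by
    have : Real.exp (-ε) < 1 := by simpa using hε
    linarith
  cases b <;> simp [bitWeight, bitError] <;> field_simp <;> ring

theorem sum_bitWeight_mul_bitError_sq_le {ε : ℝ} (hε : 0 < ε) (b : Bool) :
    ∑ b', bitWeight ε b b' * bitError ε b b' ^ 2
      ≤ ((1 + Real.exp (-ε)) / (1 - Real.exp (-ε))) ^ 2 := by
  have h : 1 + Real.exp (-ε) ≠ 0 := by positivity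
  have h0 := Real.exp_pos (-ε)
  have h' : 1 - Real.exp (-ε) ≠ 0 := by
    have : Real.exp (-ε) < 1 := by simpa using hε
    linarith
  have key : ∑ b', bitWeight ε b b' * bitError ε b b' ^ 2
      = Real.exp (-ε) / (1 - Real.exp (-ε)) ^ 2 := by
    cases b <;> simp [bitWeight, bitError] <;> field_simp <;> ring
  rw [key, div_pow]
  gcongr
  nlinarith

theorem cutEst_sub_cutQ {V : Type*} [Fintype V] [DecidableEq V] (ε : ℝ) (S T : Finset V)
    (x y : V × V → Bool) :
    cutEst ε S T y - cutQ S T x = ∑ e ∈ S ×ˢ T, bitError ε (x e) (y e) := by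
  simp only [cutEst, cutQ, bitError, Finset.sum_sub_distrib, Finset.mul_sum, Finset.sum_const,
    Finset.card_product, nsmul_eq_mul, Nat.cast_mul]
  ring

/-- For every graph database `x` and disjoint `S, T ⊆ V`, the cut-query estimator satisfies
`E_{Y∼E(x)}[|q̂_{S,T}(Y) - q_{S,T}(x)|] ≤ ((1+e^{-ε})/(1-e^{-ε})) √(|S||T|)`. -/
theorem stmt18 {V : Type*} [Fintype V] [DecidableEq V] (ε : ℝ) (hε : 0 < ε)
    (x : V × V → Bool) (S T : Finset V) (hST : Disjoint S T) :
    (∑ y : V × V → Bool, pEG ε x y * |cutEst ε S T y - cutQ S T x|)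
      ≤ ((1 + Real.exp (-ε)) / (1 - Real.exp (-ε))) * Real.sqrt ((S.card : ℝ) * T.card) := by
  have hc : 0 ≤ (1 + Real.exp (-ε)) / (1 - Real.exp (-ε)) := by
    have : Real.exp (-ε) < 1 := by simpa using hε
    exact div_nonneg (by positivity) (by linarith)
  have hw : ∀ e, ∑ b, bitWeight ε (x e) b = 1 := fun e => sum_bitWeight ε (x e)
  simp_rw [cutEst_sub_cutQ, pEG_eq_prod]
  refine (sum_mul_abs_le_sqrt _ _ (fun y => Finset.prod_nonneg fun e _ => bitWeight_nonneg ..)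
    (sum_prod_weight (fun e => bitWeight ε (x e)) hw)).trans ?_
  rw [sum_prod_weight_mul_sum_sq (fun e => bitWeight ε (x e)) hw (fun e => bitError ε (x e))
    fun e => sum_bitWeight_mul_bitError hε (x e)]
  refine Real.sqrt_le_iff.mpr ⟨by positivity, ?_⟩
  rw [mul_pow, Real.sq_sqrt (by positivity)]
  refine (Finset.sum_le_card_nsmul _ _ _ fun e _ =>
    sum_bitWeight_mul_bitError_sq_le hε (x e)).trans_eq ?_
  rw [Finset.card_product, nsmul_eq_mul, Nat.cast_mul]
  ring
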